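/- Let φ be a flow on a compact metric space M. Suppose the nonwandering set Ω(φ) equals the pairwise disjoint union {σ_1} ∪ ⋯ ∪ {σ_l} ∪ H_1 ∪ ⋯ ∪ H_m, where each σ_i is a fixed point of φ, each H_j is a compact invariant transitive set, and each of the sets {σ_i} and H_j is isolated. Then every point x ∈ M whose ω-limit set ω(x) is Lyapunov stable belongs to the basin of some attractor of φ. (Core step in the proof of Theorem A: R_X ⊆ B(X).) -/

import Mathlib

open Set Filter Topology

variable {M : Type*}

/-- The ω-limit set of a point `x` under the flow `φ`: the set of points `y` such that
`φ^{t n}(x) → y` for some sequence `t n → ∞`. -/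
def omegaPt [TopologicalSpace M] (φ : Flow ℝ M) (x : M) : Set M :=
  {y | ∃ u : ℕ → ℝ, Tendsto u atTop atTop ∧
    Tendsto (fun n => φ.toFun (u n) x) atTop (𝓝 y)}

/-- A set `S` is invariant under the flow `φ` if `φ^t(S) = S` for all `t ∈ ℝ`. -/
def IsInvariantSet [TopologicalSpace M] (φ : Flow ℝ M) (S : Set M) : Prop :=
  ∀ t : ℝ, φ.toFun t '' S = S

/-- A set `Λ` is Lyapunov stable for `φ` if every neighborhood `U` of `Λ` contains a
neighborhood `V` of `Λ` with `φ^t(V) ⊆ U` for all `t ≥ 0`. -/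
def IsLyapunovStable [TopologicalSpace M] (φ : Flow ℝ M) (Λ : Set M) : Prop :=
  ∀ U ∈ 𝓝ˢ Λ, ∃ V ∈ 𝓝ˢ Λ, V ⊆ U ∧ ∀ t : ℝ, 0 ≤ t → φ.toFun t '' V ⊆ U

/-- A set `Λ` is isolated for `φ` if it has a neighborhood `U` (an isolating block) such that
`⋂_{t ∈ ℝ} φ^t(U) = Λ`. -/
def IsIsolatedSet [TopologicalSpace M] (φ : Flow ℝ M) (Λ : Set M) : Prop :=
  ∃ U ∈ 𝓝ˢ Λ, (⋂ t : ℝ, φ.toFun t '' U) = Λ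

/-- A set `Λ` is an attracting set for `φ` if it has a neighborhood `U` with `φ^t(U) ⊆ U` for
all `t > 0` and `⋂_{t ≥ 0} φ^t(U) = Λ`. -/
def IsAttractingSet [TopologicalSpace M] (φ : Flow ℝ M) (Λ : Set M) : Prop :=
  ∃ U ∈ 𝓝ˢ Λ, (∀ t : ℝ, 0 < t → φ.toFun t '' U ⊆ U) ∧
    (⋂ t ∈ Ici (0 : ℝ), φ.toFun t '' U) = Λ

/-- A compact invariant set `Λ` is transitive if `Λ = ω(p)` for some `p ∈ Λ`. -/
def IsTransitiveSet [TopologicalSpace M] (φ : Flow ℝ M) (Λ : Set M) : Prop :=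
  IsCompact Λ ∧ IsInvariantSet φ Λ ∧ ∃ p ∈ Λ, omegaPt φ p = Λ

/-- An attractor is a transitive set which is an attracting set. -/
def IsAttractor [TopologicalSpace M] (φ : Flow ℝ M) (Λ : Set M) : Prop :=
  IsTransitiveSet φ Λ ∧ IsAttractingSet φ Λ

/-- The nonwandering set of `φ`. -/
def nonwanderingSet [TopologicalSpace M] (φ : Flow ℝ M) : Set M :=
  {x | ∀ U ∈ 𝓝 x, ∀ T : ℝ, 0 < T → ∃ t : ℝ, T < t ∧ ((φ.toFun t '' U) ∩ U).Nonempty}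

/-- A point is an ω-limit point of `x` iff it is a cluster point of the forward orbit of `x`. -/
theorem mem_omegaPt_iff [TopologicalSpace M] [FirstCountableTopology M] (φ : Flow ℝ M) (x y : M) :
    y ∈ omegaPt φ x ↔ MapClusterPt y atTop (fun t : ℝ => φ.toFun t x) := by
  constructor
  · rintro ⟨u, hu, huy⟩
    exact huy.mapClusterPt.of_comp hu
  · intro h
    obtain ⟨u, huy, hu⟩ := h.exists_seq_tendsto
    exact ⟨u, hu, huy⟩

theorem isClosed_omegaPt [TopologicalSpace M] [FirstCountableTopology M] (φ : Flow ℝ M) (x : M) :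
    IsClosed (omegaPt φ x) := by
  have h : omegaPt φ x = {y | ClusterPt y (map (fun t : ℝ => φ.toFun t x) atTop)} :=
    Set.ext fun y => mem_omegaPt_iff φ x y
  rw [h]
  exact isClosed_setOfPred_clusterPt

theorem omegaPt_nonempty [TopologicalSpace M] [FirstCountableTopology M] [CompactSpace M]
    (φ : Flow ℝ M) (x : M) : (omegaPt φ x).Nonempty := by
  obtain ⟨y, hy⟩ := exists_clusterPt_of_compactSpace (map (fun t : ℝ => φ.toFun t x) atTop)
  exact ⟨y, (mem_omegaPt_iff φ x y).2 hy⟩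

/-- The orbit of `x` visits every neighborhood of an ω-limit point at arbitrarily large times. -/
theorem exists_mem_of_mem_omegaPt [TopologicalSpace M] [FirstCountableTopology M] {φ : Flow ℝ M}
    {x y : M} (hy : y ∈ omegaPt φ x) {U : Set M} (hU : U ∈ 𝓝 y) (T : ℝ) :
    ∃ t : ℝ, T < t ∧ φ.toFun t x ∈ U := by
  have h := ((mem_omegaPt_iff φ x y).1 hy).frequently hU
  obtain ⟨t, ht, htT⟩ := (h.and_eventually (eventually_gt_atTop T)).exists
  exact ⟨t, htT, ht⟩

theorem omegaPt_subset_nonwanderingSet [TopologicalSpace M] [FirstCountableTopology M]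
    (φ : Flow ℝ M) (x : M) : omegaPt φ x ⊆ nonwanderingSet φ := by
  intro y hy U hU T _
  obtain ⟨a, -, haU⟩ := exists_mem_of_mem_omegaPt hy hU 0
  obtain ⟨b, hb, hbU⟩ := exists_mem_of_mem_omegaPt hy hU (a + T)
  refine ⟨b - a, by linarith, φ.toFun b x, ⟨φ.toFun a x, haU, ?_⟩, hbU⟩
  rw [← φ.map_add', sub_add_cancel]

/-- In a compact space the forward orbit is eventually in any open set containing the ω-limit. -/
theorem eventually_mem_of_omegaPt_subset [TopologicalSpace M] [FirstCountableTopology M]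
    [CompactSpace M] {φ : Flow ℝ M} {x : M} {O : Set M} (hO : IsOpen O) (h : omegaPt φ x ⊆ O) :
    ∀ᶠ t : ℝ in atTop, φ.toFun t x ∈ O := by
  by_contra hc
  obtain ⟨y, hyO, hy⟩ := hO.isClosed_compl.isCompact.exists_mapClusterPt_of_frequently
    (not_eventually.1 hc)
  exact hyO (h ((mem_omegaPt_iff φ x y).2 hy))

/-- An ω-limit set covered by two disjoint compact sets and meeting the first lies in the first. -/
theorem omegaPt_subset_of_subset_union [TopologicalSpace M] [T2Space M] [FirstCountableTopology M]
    [CompactSpace M] {φ : Flow ℝ M} {x : M} {K L : Set M} (hK : IsCompact K) (hL : IsCompact L)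
    (hKL : Disjoint K L) (hsub : omegaPt φ x ⊆ K ∪ L) (hne : (omegaPt φ x ∩ K).Nonempty) :
    omegaPt φ x ⊆ K := by
  obtain ⟨O, P, hO, hP, hKO, hLP, hOP⟩ := SeparatedNhds.of_isCompact_isCompact hK hL hKL
  obtain ⟨T, hT⟩ := eventually_atTop.1
    (eventually_mem_of_omegaPt_subset (hO.union hP) (hsub.trans (union_subset_union hKO hLP)))
  obtain ⟨z, hz, hzK⟩ := hne
  have hcont : Continuous fun t : ℝ => φ.toFun t x := φ.continuous continuous_id continuous_const
  have hpre : IsPreconnected ((fun t : ℝ => φ.toFun t x) '' Ici T) :=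
    isPreconnected_Ici.image _ hcont.continuousOn
  obtain ⟨s, hs, hsO⟩ := exists_mem_of_mem_omegaPt hz (hO.mem_nhds (hKO hzK)) T
  have horb : (fun t : ℝ => φ.toFun t x) '' Ici T ⊆ O :=
    hpre.subset_left_of_subset_union hO hP hOP (image_subset_iff.2 hT) ⟨_, ⟨s, hs.le, rfl⟩, hsO⟩
  intro y hy
  refine (hsub hy).resolve_right fun hyL => ?_
  obtain ⟨t, ht, htP⟩ := exists_mem_of_mem_omegaPt hy (hP.mem_nhds (hLP hyL)) T
  exact disjoint_left.1 hOP (horb ⟨t, ht.le, rfl⟩) htP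

/-- A closed Lyapunov stable set meeting an ω-limit set contains it. -/
theorem IsLyapunovStable.omegaPt_subset [TopologicalSpace M] [RegularSpace M]
    [FirstCountableTopology M] {φ : Flow ℝ M} {S : Set M} (hS : IsLyapunovStable φ S)
    (hSc : IsClosed S) {p : M} (hne : (omegaPt φ p ∩ S).Nonempty) : omegaPt φ p ⊆ S := by
  intro z hz
  by_contra hzS
  obtain ⟨K, hKz, hKc, hKS⟩ := exists_mem_nhds_isClosed_subset (hSc.isOpen_compl.mem_nhds hzS)
  obtain ⟨V, hV, -, hVK⟩ := hS Kᶜ (hKc.isOpen_compl.mem_nhdsSet.2 (subset_compl_comm.1 hKS))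
  obtain ⟨q, hq, hqS⟩ := hne
  obtain ⟨a, -, ha⟩ := exists_mem_of_mem_omegaPt hq (nhds_le_nhdsSet hqS hV) 0
  obtain ⟨b, hb, hbK⟩ := exists_mem_of_mem_omegaPt hz hKz a
  refine hVK (b - a) (by linarith) ⟨φ.toFun a p, ha, rfl⟩ ?_
  rwa [← φ.map_add', sub_add_cancel]

/-- An isolated Lyapunov stable invariant set is attracting. -/
theorem IsLyapunovStable.isAttractingSet [TopologicalSpace M] {φ : Flow ℝ M} {S : Set M}
    (hS : IsLyapunovStable φ S) (hinv : IsInvariantSet φ S) (hiso : IsIsolatedSet φ S) :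
    IsAttractingSet φ S := by
  obtain ⟨U, hU, hUS⟩ := hiso
  obtain ⟨V, hV, -, hVU⟩ := hS U hU
  set W : Set M := ⋃ t ∈ Ici (0 : ℝ), φ.toFun t '' V
  have hWU : W ⊆ U := iUnion₂_subset hVU
  have hVW : V ⊆ W := fun v hv => mem_iUnion₂.2 ⟨0, self_mem_Ici, v, hv, φ.map_zero' v⟩
  have hfwd : ∀ t : ℝ, 0 ≤ t → φ.toFun t '' W ⊆ W := by
    rintro t ht _ ⟨w, hw, rfl⟩
    obtain ⟨s, hs, v, hv, rfl⟩ := mem_iUnion₂.1 hw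
    exact mem_iUnion₂.2 ⟨t + s, add_nonneg ht hs, v, hv, φ.map_add' t s v⟩
  refine ⟨W, mem_of_superset hV hVW, fun t ht => hfwd t ht.le, Subset.antisymm ?_ ?_⟩
  · intro y hy
    rw [← hUS, mem_iInter]
    intro t
    rcases le_total 0 t with ht | ht
    · exact image_mono hWU (mem_iInter₂.1 hy t ht)
    · obtain ⟨w, hw, hwy⟩ := mem_iInter₂.1 hy 0 self_mem_Ici
      obtain rfl : w = y := (φ.map_zero' w).symm.trans hwy
      refine ⟨φ.toFun (-t) w, hWU (hfwd (-t) (by linarith) ⟨w, hw, rfl⟩), ?_⟩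
      rw [← φ.map_add', add_neg_cancel, φ.map_zero']
  · refine subset_iInter₂ fun t _ => ?_
    rw [← hinv t]
    exact image_mono ((subset_of_mem_nhdsSet hV).trans hVW)

/-- If the nonwandering set is covered by finitely many disjoint isolated transitive sets, then a
Lyapunov stable ω-limit set is an attractor. -/
theorem isAttractor_omegaPt_of_isLyapunovStable [TopologicalSpace M] [T2Space M]
    [FirstCountableTopology M] [CompactSpace M] {φ : Flow ℝ M} {ι : Type*} [Finite ι]
    {K : ι → Set M} (htrans : ∀ i, IsTransitiveSet φ (K i))
    (hdisj : Pairwise fun i j => Disjoint (K i) (K j)) (hcover : nonwanderingSet φ ⊆ ⋃ i, K i)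
    (hiso : ∀ i, IsIsolatedSet φ (K i)) {x : M} (hx : IsLyapunovStable φ (omegaPt φ x)) :
    IsAttractor φ (omegaPt φ x) := by
  have hsub := (omegaPt_subset_nonwanderingSet φ x).trans hcover
  obtain ⟨y, hy⟩ := omegaPt_nonempty φ x
  obtain ⟨i, hyi⟩ := mem_iUnion.1 (hsub hy)
  have hle : omegaPt φ x ⊆ K i := by
    have hL : IsCompact (⋃ j ∈ {j | j ≠ i}, K j) :=
      (toFinite {j | j ≠ i}).isCompact_biUnion fun j _ => (htrans j).1
    refine omegaPt_subset_of_subset_union (htrans i).1 hL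
      (disjoint_iUnion₂_right.2 fun j hj => hdisj (Ne.symm hj)) (fun z hz => ?_) ⟨y, hy, hyi⟩
    obtain ⟨j, hj⟩ := mem_iUnion.1 (hsub hz)
    rcases eq_or_ne j i with rfl | hji
    · exact Or.inl hj
    · exact Or.inr (mem_iUnion₂.2 ⟨j, hji, hj⟩)
  have heq : omegaPt φ x = K i := by
    obtain ⟨-, -, p, -, hp⟩ := htrans i
    refine hle.antisymm ?_
    rw [← hp]
    exact hx.omegaPt_subset (isClosed_omegaPt φ x) ⟨y, hp.symm ▸ hyi, hy⟩
  rw [heq] at hx ⊢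
  exact ⟨htrans i, hx.isAttractingSet (htrans i).2.1 (hiso i)⟩

/-- The singleton of a fixed point is a transitive set. -/
theorem isTransitiveSet_singleton [TopologicalSpace M] [T2Space M] {φ : Flow ℝ M} {p : M}
    (hp : ∀ t : ℝ, φ.toFun t p = p) : IsTransitiveSet φ {p} := by
  refine ⟨isCompact_singleton, fun t => by rw [image_singleton, hp], p, rfl, ?_⟩
  ext y
  constructor
  · rintro ⟨u, -, huy⟩
    simp only [hp] at huy
    exact tendsto_nhds_unique huy tendsto_const_nhds
  · rintro rfl
    refine ⟨fun n => n, tendsto_natCast_atTop_atTop, ?_⟩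
    simp only [hp]
    exact tendsto_const_nhds

/-- core step of Theorem A: `R_X ⊆ B(X)`: Suppose the nonwandering set
of a flow `φ` on a compact metric space is the pairwise disjoint union
`{σ 1} ∪ ⋯ ∪ {σ l} ∪ H 1 ∪ ⋯ ∪ H m`, where each `σ i` is a fixed point, each `H j` is a
compact invariant transitive set, and each of the sets `{σ i}` and `H j` is isolated.
Then every point `x` whose ω-limit set is Lyapunov stable belongs to the basin of some
attractor of `φ`. -/
theorem mem_basin_of_attractor_of_lyapunovStable_omega
    [MetricSpace M] [CompactSpace M] (φ : Flow ℝ M)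
    {l m : ℕ} (σ : Fin l → M) (H : Fin m → Set M)
    (hσfix : ∀ i, ∀ t : ℝ, φ.toFun t (σ i) = σ i)
    (hHcomp : ∀ j, IsCompact (H j))
    (hHinv : ∀ j, IsInvariantSet φ (H j))
    (hHtrans : ∀ j, ∃ p ∈ H j, omegaPt φ p = H j)
    (hσinj : Function.Injective σ)
    (hσH : ∀ i j, σ i ∉ H j)
    (hHdisj : ∀ j j', j ≠ j' → Disjoint (H j) (H j'))
    (hΩ : nonwanderingSet φ = (⋃ i, {σ i}) ∪ ⋃ j, H j)
    (hσiso : ∀ i, IsIsolatedSet φ {σ i})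
    (hHiso : ∀ j, IsIsolatedSet φ (H j))
    (x : M) (hx : IsLyapunovStable φ (omegaPt φ x)) :
    ∃ Λ : Set M, IsAttractor φ Λ ∧ omegaPt φ x ⊆ Λ := by
  refine ⟨omegaPt φ x, isAttractor_omegaPt_of_isLyapunovStable
    (K := Sum.elim (fun i => {σ i}) H) ?_ ?_ ?_ ?_ hx, Subset.rfl⟩
  · rintro (i | j)
    · exact isTransitiveSet_singleton (hσfix i)
    · exact ⟨hHcomp j, hHinv j, hHtrans j⟩
  · rintro (i | j) (i' | j') hne
    · exact disjoint_singleton.2 fun h => hne (congrArg Sum.inl (hσinj h))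
    · exact disjoint_singleton_left.2 (hσH i j')
    · exact disjoint_singleton_right.2 (hσH i' j)
    · exact hHdisj j j' fun h => hne (congrArg Sum.inr h)
  · rw [hΩ, iUnion_sum]
    exact Subset.rfl
  · rintro (i | j)
    · exact hσiso i
    · exact hHiso j
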